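/- arXiv:2201.13283 — 2 statements merged into one kernel-verified Lean document; each statement's English description precedes it below -/
import Mathlib

section
/- Let G be a group, M ⊆ G a subset (not necessarily finite), A a set, and S = A^(A^M). If a sequence (s_n) in S^G converges to s ∈ S^G with respect to the prodiscrete topology, then for every x ∈ A^G, the sequence (σ_{s_n}(x)) converges to σ_s(x) in A^G. -/
open Pointwise

section ANUCA

variable {G : Type*} [Group G] {A : Type*}

/-- The shift action of `G` on configurations: `(g · x) h = x (g⁻¹ * h)`. -/
def shiftC {S : Type*} (g : G) (x : G → S) : G → S := fun h => x (g⁻¹ * h)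

/-- The prodiscrete topology on `G → S` (product topology, `S` discrete). -/
def prodiscrete (G S : Type*) : TopologicalSpace (G → S) :=
  @Pi.topologicalSpace G (fun _ => S) (fun _ => ⊥)

/-- `Σ(s)`: the closure of the shift orbit of `s` in the prodiscrete topology. -/
def orbitClosure {S : Type*} (s : G → S) : Set (G → S) :=
  @closure _ (prodiscrete G S) {p | ∃ g : G, shiftC g s = p}

/-- The ANUCA `σ_s` with memory `M` associated with the configuration of local
defining maps `s : G → (A^M → A)`, namely `σ_s x g = s g ((g⁻¹ · x)|_M)`. -/
def anuca (M : Set G) (s : G → ((M → A) → A)) (x : G → A) : G → A :=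
  fun g => s g (fun m => x (g * (m : G)))

/-- `σ_s` is stably injective if `σ_p` is injective for every `p ∈ Σ(s)`. -/
def StablyInjective (M : Set G) (s : G → ((M → A) → A)) : Prop :=
  ∀ p ∈ orbitClosure s, Function.Injective (anuca M p)

/-- `σ_s` is reversible if `σ_w ∘ σ_s = Id` for some ANUCA `σ_w` with finite memory. -/
def Reversible (M : Set G) (s : G → ((M → A) → A)) : Prop :=
  ∃ N : Set G, N.Finite ∧ ∃ w : G → ((N → A) → A), anuca N w ∘ anuca M s = id

/-- `σ_s` is stably reversible if there are a finite `N ⊆ G` and `q ∈ T^G`,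
`T = A^(A^N)`, such that every `p ∈ Σ(s)` admits `w ∈ Σ(q)` with `σ_w ∘ σ_p = Id`. -/
def StablyReversible (M : Set G) (s : G → ((M → A) → A)) : Prop :=
  ∃ N : Set G, N.Finite ∧ ∃ q : G → ((N → A) → A),
    ∀ p ∈ orbitClosure s, ∃ w ∈ orbitClosure q, anuca N w ∘ anuca M p = id

/-- `σ_s` is invertible if it is bijective and its inverse is an ANUCA with finite memory. -/
def InvertibleANUCA (M : Set G) (s : G → ((M → A) → A)) : Prop :=
  Function.Bijective (anuca M s) ∧
    ∃ N : Set G, N.Finite ∧ ∃ w : G → ((N → A) → A),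
      anuca N w ∘ anuca M s = id ∧ anuca M s ∘ anuca N w = id

/-- Two configurations are asymptotic if they agree outside a finite set. -/
def Asymptotic {S : Type*} (x y : G → S) : Prop := {g : G | x g ≠ y g}.Finite

/-- A map `τ : A^G → A^G` is pre-injective if it is injective on asymptotic pairs. -/
def PreInjective (τ : (G → A) → (G → A)) : Prop :=
  ∀ x y : G → A, Asymptotic x y → τ x = τ y → x = y

/-- A map `τ : A^G → A^G` is post-surjective if every configuration asymptotic to
`τ x` is the image of a configuration asymptotic to `x`. -/
def PostSurjective (τ : (G → A) → (G → A)) : Prop :=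
  ∀ x y : G → A, Asymptotic y (τ x) → ∃ z : G → A, Asymptotic z x ∧ τ z = y

end ANUCA


theorem tendsto_prodiscrete_iff {ι G S : Type*} {l : Filter ι} {u : ι → G → S} {p : G → S} :
    Filter.Tendsto u l (@nhds _ (prodiscrete G S) p) ↔
      ∀ g, ∀ᶠ n in l, u n g = p g := by
  let _ : TopologicalSpace S := ⊥
  have : DiscreteTopology S := ⟨rfl⟩
  change Filter.Tendsto u l (nhds p) ↔ _
  simp only [tendsto_pi_nhds, nhds_discrete, Filter.tendsto_pure]

/-- If `s_n → s` in `S^G` (prodiscrete topology, `M` not necessarily finite), then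
`σ_{s_n}(x) → σ_s(x)` for every `x ∈ A^G`. -/
theorem stmt8 {G A : Type*} [Group G] (M : Set G)
    (s : G → ((M → A) → A)) (sn : ℕ → (G → ((M → A) → A)))
    (hs : Filter.Tendsto sn Filter.atTop (@nhds _ (prodiscrete G ((M → A) → A)) s))
    (x : G → A) :
    Filter.Tendsto (fun n => anuca M (sn n) x) Filter.atTop
      (@nhds _ (prodiscrete G A) (anuca M s x)) := by
  rw [tendsto_prodiscrete_iff] at hs ⊢
  exact fun g => (hs g).mono fun n hn => congrFun hn _
end

section
/- Let G be a group, M ⊆ G a subset, A a set, and S = A^(A^M). Let p, q, s ∈ S^G and suppose σ_p ∘ σ_q = σ_s. Then for every g ∈ G, σ_{g·p} ∘ σ_{g·q} = σ_{g·s}. In particular, if σ_p ∘ σ_q = Id on A^G, then σ_{g·p} ∘ σ_{g·q} = Id for every g ∈ G. -/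
open Pointwise

/-- The ANUCA of a shifted configuration of local maps is the conjugate by the shift. -/
theorem anuca_shiftC {G A : Type*} [Group G] (M : Set G) (g : G) (s : G → ((M → A) → A))
    (x : G → A) :
    anuca M (shiftC g s) x = shiftC g (anuca M s (shiftC g⁻¹ x)) := by
  funext h
  simp [anuca, shiftC, mul_assoc]

theorem shiftC_inv_shiftC {G S : Type*} [Group G] (g : G) (x : G → S) :
    shiftC g⁻¹ (shiftC g x) = x := by
  funext h
  simp [shiftC]

theorem shiftC_shiftC_inv {G S : Type*} [Group G] (g : G) (x : G → S) :
    shiftC g (shiftC g⁻¹ x) = x := by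
  funext h
  simp [shiftC]

theorem anuca_shiftC_comp {G A : Type*} [Group G] (M : Set G) (g : G)
    (p q : G → ((M → A) → A)) (x : G → A) :
    (anuca M (shiftC g p) ∘ anuca M (shiftC g q)) x =
      shiftC g ((anuca M p ∘ anuca M q) (shiftC g⁻¹ x)) := by
  simp only [Function.comp_apply, anuca_shiftC, shiftC_inv_shiftC]

/-- If `σ_p ∘ σ_q = σ_s` then `σ_{g·p} ∘ σ_{g·q} = σ_{g·s}` for all `g ∈ G`; in particular
if `σ_p ∘ σ_q = Id` then `σ_{g·p} ∘ σ_{g·q} = Id` for all `g ∈ G`. -/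
theorem stmt12 {G A : Type*} [Group G] (M : Set G) (p q s : G → ((M → A) → A))
    (h : anuca M p ∘ anuca M q = anuca M s) :
    (∀ g : G, anuca M (shiftC g p) ∘ anuca M (shiftC g q) = anuca M (shiftC g s)) ∧
    (anuca M p ∘ anuca M q = id →
      ∀ g : G, anuca M (shiftC g p) ∘ anuca M (shiftC g q) = id) := by
  refine ⟨fun g => funext fun x => ?_, fun hid g => funext fun x => ?_⟩
  · rw [anuca_shiftC_comp, h, anuca_shiftC]
  · rw [anuca_shiftC_comp, hid, id, shiftC_shiftC_inv, id]
end
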